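/- Suppose q belongs to the set U of univoque numbers. Then every x ∈ V_q ∖ U_q has exactly two expansions in base q, i.e., the set of sequences (c_i) of integers with 0 ≤ c_i ≤ ⌈q⌉ − 1 and ∑_{i=1}^∞ c_i q^{−i} = x has exactly two elements. -/

import Mathlib

open Classical

noncomputable section

/-- The largest digit in base `q`: `α₁ = ⌈q⌉ - 1`. -/
def alphaOne (q : ℝ) : ℕ := (⌈q⌉ - 1).toNat

/-- `c` (0-indexed: `c i` is the digit `c_{i+1}` of the paper) is an expansion of `x`
in base `q`: all digits lie in `{0, …, α₁}` and `x = ∑_{i≥1} c_i q^{-i}`. -/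
def IsExpansionOf (q x : ℝ) (c : ℕ → ℕ) : Prop :=
  (∀ i, c i ≤ alphaOne q) ∧ x = ∑' i, (c i : ℝ) / q ^ (i + 1)

/-- A sequence is called infinite if it has infinitely many nonzero terms. -/
def InfiniteSeq (c : ℕ → ℕ) : Prop := {i | c i ≠ 0}.Infinite

/-- Strict lexicographic order on sequences. -/
def LexLt (a b : ℕ → ℕ) : Prop := ∃ n, (∀ i, i < n → a i = b i) ∧ a n < b n

/-- Lexicographic order `≤` on sequences. -/
def LexLe (a b : ℕ → ℕ) : Prop := LexLt a b ∨ a = b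

/-- `b` is the greedy (lexicographically largest) expansion of `x` in base `q`. -/
def IsGreedyOf (q x : ℝ) (b : ℕ → ℕ) : Prop :=
  IsExpansionOf q x b ∧ ∀ c, IsExpansionOf q x c → LexLe c b

/-- `a` is the quasi-greedy (lexicographically largest infinite) expansion of `x`
in base `q`. -/
def IsQuasiGreedyOf (q x : ℝ) (a : ℕ → ℕ) : Prop :=
  IsExpansionOf q x a ∧ InfiniteSeq a ∧
    ∀ c, IsExpansionOf q x c → InfiniteSeq c → LexLe c a

/-- The quasi-greedy expansion of `x` in base `q`; by convention it is the zero
sequence whenever no infinite expansion exists (in particular for `x = 0`). -/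
def quasiGreedy (q x : ℝ) : ℕ → ℕ :=
  if h : ∃ a, IsQuasiGreedyOf q x a then h.choose else fun _ => 0

/-- The greedy expansion of `x` in base `q` (zero sequence if `x` has no expansion). -/
def greedy (q x : ℝ) : ℕ → ℕ :=
  if h : ∃ b, IsGreedyOf q x b then h.choose else fun _ => 0

/-- The interval `J_q = [0, α₁/(q-1)]`. -/
def Jq (q : ℝ) : Set ℝ := Set.Icc 0 ((alphaOne q : ℝ) / (q - 1))

/-- `U_q`: the set of real numbers having exactly one expansion in base `q`. -/
def Uq (q : ℝ) : Set ℝ := {x | ∃! c, IsExpansionOf q x c}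

/-- `U_q'`: the set of univoque sequences in base `q`. -/
def UqSeq (q : ℝ) : Set (ℕ → ℕ) := {c | ∃ x ∈ Uq q, IsExpansionOf q x c}

/-- `U`: the set of univoque numbers. -/
def USet : Set ℝ := {q | 1 < q ∧ ∃! c, IsExpansionOf q 1 c}

/-- `V_q`: the set of `x ∈ J_q` such that for every `n ≥ 1` with `a_n(x) > 0` the
conjugated shifted quasi-greedy expansion is lexicographically at most `(α_i)`. -/
def Vq (q : ℝ) : Set ℝ :=
  {x | x ∈ Jq q ∧ ∀ n, 0 < quasiGreedy q x n →
    LexLe (fun i => alphaOne q - quasiGreedy q x (n + 1 + i)) (quasiGreedy q 1)}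

/-- `V`: the set of `q > 1` whose quasi-greedy expansion `(α_i)` of `1` satisfies
`(α₁ - α_{k+i})_{i≥1} ≤ (α_i)_{i≥1}` lexicographically for all `k ≥ 1`. -/
def VSet : Set ℝ :=
  {q | 1 < q ∧ ∀ k, LexLe (fun i => alphaOne q - quasiGreedy q 1 (k + 1 + i)) (quasiGreedy q 1)}

/-- The value in base `q` of the tail of `c` that starts at index `n`. -/
def tailVal (q : ℝ) (c : ℕ → ℕ) (n : ℕ) : ℝ := ∑' i, (c (n + i) : ℝ) / q ^ (i + 1)

theorem alphaOne_lt {q : ℝ} (hq : 1 < q) : (alphaOne q : ℝ) < q := by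
  have h1 : 1 < ⌈q⌉ := Int.lt_ceil.2 (by exact_mod_cast hq)
  have h2 : ((alphaOne q : ℕ) : ℤ) = ⌈q⌉ - 1 := Int.toNat_of_nonneg (by omega)
  have h3 : (alphaOne q : ℝ) = (⌈q⌉ : ℝ) - 1 := by exact_mod_cast congrArg (Int.cast (R := ℝ)) h2
  have := Int.ceil_lt_add_one q
  linarith

theorem sub_one_le_alphaOne {q : ℝ} (hq : 1 < q) : q - 1 ≤ alphaOne q := by
  have h1 : 1 < ⌈q⌉ := Int.lt_ceil.2 (by exact_mod_cast hq)
  have h2 : ((alphaOne q : ℕ) : ℤ) = ⌈q⌉ - 1 := Int.toNat_of_nonneg (by omega)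
  have h3 : (alphaOne q : ℝ) = (⌈q⌉ : ℝ) - 1 := by exact_mod_cast congrArg (Int.cast (R := ℝ)) h2
  have := Int.le_ceil q
  linarith

theorem one_le_div_alphaOne {q : ℝ} (hq : 1 < q) : 1 ≤ (alphaOne q : ℝ) / (q - 1) := by
  rw [le_div_iff₀ (by linarith), one_mul]
  exact sub_one_le_alphaOne hq

theorem nonpos_of_forall_mul_pow_le {q y M : ℝ} (hq : 1 < q) (h : ∀ N : ℕ, y * q ^ N ≤ M) :
    y ≤ 0 := by
  by_contra! hy
  obtain ⟨N, hN⟩ := pow_unbounded_of_one_lt (M / y) hq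
  rw [div_lt_iff₀ hy] at hN
  linarith [h N, mul_comm y (q ^ N)]

theorem hasSum_const_div_pow {q : ℝ} (hq : 1 < q) (m : ℝ) :
    HasSum (fun i : ℕ => m / q ^ (i + 1)) (m / (q - 1)) := by
  have h := (hasSum_geometric_of_lt_one (r := q⁻¹) (by positivity)
    (inv_lt_one_of_one_lt₀ hq)).mul_left (m / q)
  have hq1 : q - 1 ≠ 0 := by linarith
  have hq0 : q ≠ 0 := by linarith
  have hfun : (fun i : ℕ => m / q ^ (i + 1)) = fun i => m / q * q⁻¹ ^ i := by
    funext i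
    rw [inv_pow, pow_succ]
    field_simp
  have hval : m / (q - 1) = m / q * (1 - q⁻¹)⁻¹ := by
    have : 1 - q⁻¹ = (q - 1) / q := by field_simp
    rw [this]
    field_simp
  rw [hfun, hval]
  exact h

section Tails

variable {q : ℝ} {m : ℕ} {c : ℕ → ℕ}

theorem summable_tail (hq : 1 < q) (hc : ∀ i, c i ≤ m) (n : ℕ) :
    Summable fun i => (c (n + i) : ℝ) / q ^ (i + 1) := by
  refine Summable.of_nonneg_of_le (fun i => by positivity) (fun i => ?_)
    (hasSum_const_div_pow hq m).summable
  gcongr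
  exact hc _

theorem tailVal_nonneg (hq : 1 < q) (c : ℕ → ℕ) (n : ℕ) : 0 ≤ tailVal q c n :=
  tsum_nonneg fun i => by positivity

theorem tailVal_add (q : ℝ) (c : ℕ → ℕ) (k n : ℕ) :
    tailVal q (fun i => c (k + i)) n = tailVal q c (k + n) := by
  simp only [tailVal, add_assoc]

theorem mul_tailVal (hq : 1 < q) (hc : ∀ i, c i ≤ m) (n : ℕ) :
    q * tailVal q c n = c n + tailVal q c (n + 1) := by
  have hq0 : q ≠ 0 := by linarith
  rw [tailVal, (summable_tail hq hc n).tsum_eq_zero_add, mul_add, ← tsum_mul_left, tailVal]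
  congr 1
  · simp only [add_zero, zero_add, pow_one]
    field_simp
  · refine tsum_congr fun i => ?_
    rw [show n + (i + 1) = n + 1 + i by ring, pow_succ q (i + 1)]
    field_simp

theorem tailVal_conj (hq : 1 < q) (hc : ∀ i, c i ≤ m) (n : ℕ) :
    tailVal q (fun i => m - c i) n = m / (q - 1) - tailVal q c n := by
  have h := (hasSum_const_div_pow hq m).sub (summable_tail hq hc n).hasSum
  rw [tailVal, tailVal, ← h.tsum_eq]
  refine tsum_congr fun i => ?_
  rw [Nat.cast_sub (hc _), sub_div]

theorem tailVal_le (hq : 1 < q) (hc : ∀ i, c i ≤ m) (n : ℕ) :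
    tailVal q c n ≤ m / (q - 1) := by
  have := tailVal_nonneg hq (fun i => m - c i) n
  rw [tailVal_conj hq hc] at this
  linarith

theorem eq_zero_of_tailVal_nonpos (hq : 1 < q) (hc : ∀ i, c i ≤ m) {n : ℕ}
    (h : tailVal q c n ≤ 0) (i : ℕ) : c (n + i) = 0 := by
  have h0 : tailVal q c n = 0 := h.antisymm (tailVal_nonneg hq c n)
  have hs := summable_tail hq hc n
  have hsum : HasSum (fun i => (c (n + i) : ℝ) / q ^ (i + 1)) 0 := h0 ▸ hs.hasSum
  have hz := (hasSum_zero_iff_of_nonneg (fun i => by positivity)).1 hsum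
  have := congrFun hz i
  have hq0 : q ≠ 0 := by linarith
  simpa [hq0] using this

theorem eq_max_of_le_tailVal (hq : 1 < q) (hc : ∀ i, c i ≤ m) {n : ℕ}
    (h : m / (q - 1) ≤ tailVal q c n) (i : ℕ) : c (n + i) = m := by
  have := eq_zero_of_tailVal_nonpos hq (c := fun i => m - c i) (fun i => Nat.sub_le m _) (n := n)
    (by rw [tailVal_conj hq hc]; linarith) i
  have := hc (n + i)
  omega

theorem tailVal_eq_of_agree {d : ℕ → ℕ} (hq : 1 < q) (hc : ∀ i, c i ≤ m) (hd : ∀ i, d i ≤ m)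
    (h0 : tailVal q c 0 = tailVal q d 0) {n : ℕ} (h : ∀ i < n, c i = d i) :
    tailVal q c n = tailVal q d n := by
  induction n with
  | zero => exact h0
  | succ n ih =>
    have h1 := mul_tailVal hq hc n
    have h2 := mul_tailVal hq hd n
    rw [ih fun i hi => h i (by omega), h n (by omega)] at h1
    linarith

theorem tailVal_of_remainders (hq : 1 < q) (hc : ∀ i, c i ≤ m) {r : ℕ → ℝ}
    (hr0 : ∀ n, 0 ≤ r n) (hrM : ∀ n, r n ≤ m / (q - 1))
    (hr : ∀ n, r (n + 1) = q * r n - c n) (n : ℕ) : tailVal q c n = r n := by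
  have key : ∀ N, (tailVal q c n - r n) * q ^ N = tailVal q c (n + N) - r (n + N) := by
    intro N
    induction N with
    | zero => simp
    | succ N ih =>
      rw [pow_succ, ← mul_assoc, ih, ← add_assoc, hr, sub_mul]
      linarith [mul_tailVal hq hc (n + N)]
  refine le_antisymm ?_ ?_
  · have := nonpos_of_forall_mul_pow_le (y := tailVal q c n - r n) hq (M := m / (q - 1))
      fun N => by rw [key]; linarith [tailVal_le hq hc (n + N), hr0 (n + N)]
    linarith
  · have := nonpos_of_forall_mul_pow_le (y := -(tailVal q c n - r n)) hq (M := m / (q - 1))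
      fun N => by rw [neg_mul, key]; linarith [tailVal_nonneg hq c (n + N), hrM (n + N)]
    linarith

theorem tailVal_pos_of_infiniteSeq (hq : 1 < q) (hc : ∀ i, c i ≤ m) (h : InfiniteSeq c) (n : ℕ) :
    0 < tailVal q c n := by
  by_contra! hn
  obtain ⟨k, hk, hnk⟩ := h.exists_gt n
  apply hk
  have := eq_zero_of_tailVal_nonpos hq hc hn (k - n)
  rwa [Nat.add_sub_cancel' hnk.le] at this

end Tails

theorem isExpansionOf_iff {q x : ℝ} {c : ℕ → ℕ} :
    IsExpansionOf q x c ↔ (∀ i, c i ≤ alphaOne q) ∧ tailVal q c 0 = x := by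
  simp only [IsExpansionOf, tailVal, zero_add, eq_comm]

theorem isExpansionOf_shift {q : ℝ} {c : ℕ → ℕ} (hc : ∀ i, c i ≤ alphaOne q) (n : ℕ) :
    IsExpansionOf q (tailVal q c n) fun i => c (n + i) :=
  ⟨fun _ => hc _, rfl⟩

theorem LexLe.antisymm {a b : ℕ → ℕ} (hab : LexLe a b) (hba : LexLe b a) : a = b := by
  rcases hab with ⟨n, hn, hn'⟩ | h
  · rcases hba with ⟨k, hk, hk'⟩ | h
    · rcases lt_trichotomy n k with h | h | h
      · have := hk n h; omega
      · subst h; omega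
      · have := hn k h; omega
    · exact h.symm
  · exact h

theorem exists_first_diff {a b : ℕ → ℕ} (h : a ≠ b) :
    ∃ n, (∀ i < n, a i = b i) ∧ a n ≠ b n := by
  have hex := Function.ne_iff.1 h
  exact ⟨Nat.find hex, fun i hi => not_not.1 (Nat.find_min hex hi), Nat.find_spec hex⟩

/-- The quasi-greedy algorithm produces the quasi-greedy expansion. -/
theorem exists_isQuasiGreedyOf {q x : ℝ} (hq : 1 < q) (hx : 0 < x)
    (hxM : x ≤ (alphaOne q : ℝ) / (q - 1)) :
    ∃ a, IsQuasiGreedyOf q x a ∧ ∀ n, a n < alphaOne q → tailVal q a (n + 1) ≤ 1 := by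
  set m := alphaOne q
  let d : ℝ → ℕ := fun y => min m (⌈q * y⌉₊ - 1)
  let r : ℕ → ℝ := fun n => Nat.rec x (fun _ y => q * y - d y) n
  have hd : ∀ y, 0 < y → (d y : ℝ) < q * y := by
    intro y hy
    have hqy : 0 < q * y := by positivity
    have h1 : 0 < ⌈q * y⌉₊ := Nat.ceil_pos.2 hqy
    have h2 : d y < ⌈q * y⌉₊ := by
      have : d y ≤ ⌈q * y⌉₊ - 1 := min_le_right _ _
      omega
    exact Nat.lt_ceil.1 h2
  have hd1 : ∀ y, d y < m → q * y - d y ≤ 1 := by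
    intro y hy
    have h1 : d y = ⌈q * y⌉₊ - 1 := by
      rcases min_choice m (⌈q * y⌉₊ - 1) with h | h
      · exact absurd h hy.ne
      · exact h
    have h2 : ⌈q * y⌉₊ ≤ d y + 1 := by omega
    have h3 : q * y ≤ ((d y + 1 : ℕ) : ℝ) := Nat.ceil_le.1 h2
    push_cast at h3
    linarith
  have hdm : ∀ y, d y ≤ m := fun y => min_le_left _ _
  have hM := one_le_div_alphaOne hq
  have hr : ∀ n, 0 < r n ∧ r n ≤ m / (q - 1) := by
    intro n
    induction n with
    | zero => exact ⟨hx, hxM⟩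
    | succ n ih =>
      refine ⟨sub_pos.2 (hd _ ih.1), ?_⟩
      change q * r n - d (r n) ≤ _
      rcases (hdm (r n)).lt_or_eq with h | h
      · exact (hd1 _ h).trans hM
      · rw [h]
        have h1 : q * r n ≤ q * (m / (q - 1)) := by gcongr; exact ih.2
        have h2 : q * ((m : ℝ) / (q - 1)) - m = m / (q - 1) := by
          have : q - 1 ≠ 0 := by linarith
          field_simp
          ring
        linarith
  have ht := tailVal_of_remainders (c := fun n => d (r n)) hq (fun i => hdm _)
    (fun n => (hr n).1.le) (fun n => (hr n).2) fun n => rfl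
  have ht1 : ∀ n, d (r n) < m → tailVal q (fun n => d (r n)) (n + 1) ≤ 1 := by
    intro n hn
    rw [ht]
    exact hd1 _ hn
  refine ⟨fun n => d (r n), ⟨isExpansionOf_iff.2 ⟨fun i => hdm _, ht 0⟩, ?_, ?_⟩, ht1⟩
  · intro hfin
    obtain ⟨n, hn⟩ := hfin.bddAbove
    have h0 : tailVal q (fun n => d (r n)) (n + 1) = 0 := by
      rw [tailVal]
      convert tsum_zero with i
      have : d (r (n + 1 + i)) = 0 := by
        by_contra h
        have := hn h
        omega
      simp [this]
    rw [ht] at h0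
    exact (hr (n + 1)).1.ne' h0
  · intro c hc hinf
    rw [isExpansionOf_iff] at hc
    by_cases heq : c = fun n => d (r n)
    · exact Or.inr heq
    obtain ⟨n, hn, hne⟩ := exists_first_diff heq
    refine Or.inl ⟨n, hn, lt_of_le_of_ne (not_lt.1 fun hlt => ?_) hne⟩
    have h1 := tailVal_eq_of_agree hq hc.1 (fun i => hdm _) (hc.2.trans (ht 0).symm) hn
    have h2 := mul_tailVal hq hc.1 n
    have h3 := mul_tailVal (c := fun n => d (r n)) hq (fun i => hdm _) n
    have h4 := ht1 n (hlt.trans_le (hc.1 n))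
    have h5 := tailVal_pos_of_infiniteSeq hq hc.1 hinf (n + 1)
    have h6 : (d (r n) : ℝ) + 1 ≤ c n := by exact_mod_cast hlt
    rw [h1] at h2
    linarith

theorem quasiGreedy_spec {q x : ℝ} (hq : 1 < q) (hx : 0 < x)
    (hxM : x ≤ (alphaOne q : ℝ) / (q - 1)) :
    IsExpansionOf q x (quasiGreedy q x) ∧
      ∀ n, quasiGreedy q x n < alphaOne q → tailVal q (quasiGreedy q x) (n + 1) ≤ 1 := by
  obtain ⟨a, ha, ha1⟩ := exists_isQuasiGreedyOf hq hx hxM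
  have hex : ∃ a, IsQuasiGreedyOf q x a := ⟨a, ha⟩
  have hg : IsQuasiGreedyOf q x (quasiGreedy q x) := by
    rw [quasiGreedy, dif_pos hex]
    exact hex.choose_spec
  have : quasiGreedy q x = a :=
    (ha.2.2 _ hg.1 hg.2.1).antisymm (hg.2.2 _ ha.1 ha.2.1)
  rw [this]
  exact ⟨ha.1, ha1⟩

/-- If the tails of `b` that follow a non-maximal digit are lexicographically at most an
expansion of `1`, then every tail of `b` with this property has value at most `1`. -/
theorem tailVal_le_one_of_lexLe {q : ℝ} {m : ℕ} (hq : 1 < q) {e b : ℕ → ℕ} (he : ∀ i, e i ≤ m)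
    (he1 : tailVal q e 0 = 1) (hb : ∀ i, b i ≤ m)
    (hlex : ∀ n, b n < m → LexLe (fun i => b (n + 1 + i)) e) {n : ℕ}
    (hn : LexLe (fun i => b (n + i)) e) : tailVal q b n ≤ 1 := by
  have key : ∀ N n, LexLe (fun i => b (n + i)) e →
      (tailVal q b n - 1) * q ^ N ≤ m / (q - 1) := by
    intro N
    induction N with
    | zero =>
      intro n _
      linarith [tailVal_le hq hb n]
    | succ N ih =>
      intro n hn
      have hM : (0 : ℝ) ≤ m / (q - 1) := div_nonneg (by positivity) (by linarith)
      rcases hn with ⟨k, hk, hk'⟩ | h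
      · have hstep : ∀ j ≤ k, (tailVal q b n - 1) * q ^ j
            = tailVal q b (n + j) - tailVal q e j := by
          intro j hj
          induction j with
          | zero => simp [he1]
          | succ j ihj =>
            have hbe : b (n + j) = e j := hk j (by omega)
            have h1 := mul_tailVal hq hb (n + j)
            have h2 := mul_tailVal hq he j
            rw [pow_succ, ← mul_assoc, ihj (by omega), sub_mul, ← add_assoc]
            rw [hbe] at h1
            linarith
        have h0 := hstep k le_rfl
        have h1 := mul_tailVal hq hb (n + k)
        have h2 := mul_tailVal hq he k
        have h3 : (b (n + k) : ℝ) + 1 ≤ e k := by exact_mod_cast hk'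
        have h4 := tailVal_nonneg hq e (k + 1)
        have h5 : (tailVal q b n - 1) * q ^ (k + 1) ≤ tailVal q b (n + k + 1) - 1 := by
          rw [pow_succ, ← mul_assoc, h0, sub_mul]
          linarith
        have h6 := ih (n + k + 1) (hlex _ (lt_of_lt_of_le hk' (he k)))
        by_cases hpos : tailVal q b n ≤ 1
        · have : (tailVal q b n - 1) * q ^ (N + 1) ≤ 0 :=
            mul_nonpos_of_nonpos_of_nonneg (by linarith) (by positivity)
          linarith
        · calc (tailVal q b n - 1) * q ^ (N + 1)
              ≤ (tailVal q b n - 1) * q ^ (k + 1 + N) := by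
                have : 0 ≤ tailVal q b n - 1 := by linarith
                exact mul_le_mul_of_nonneg_left (pow_le_pow_right₀ hq.le (by omega)) this
            _ = (tailVal q b n - 1) * q ^ (k + 1) * q ^ N := by rw [pow_add, mul_assoc]
            _ ≤ (tailVal q b (n + k + 1) - 1) * q ^ N := by gcongr
            _ ≤ _ := h6
      · have : tailVal q b n = 1 := by
          rw [← he1, ← h, tailVal_add, add_zero]
        rw [this, sub_self, zero_mul]
        exact hM
  linarith [nonpos_of_forall_mul_pow_le hq fun N => key N n hn]

/-- Two expansions of the same number that first differ at index `n` are adjacent there, and the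
second one continues with extreme digits, if the tails of the first are suitably bounded. -/
theorem first_diff_cases {q : ℝ} {m : ℕ} (hq : 1 < q) {a c : ℕ → ℕ} (ha : ∀ i, a i ≤ m)
    (hc : ∀ i, c i ≤ m) (h0 : tailVal q c 0 = tailVal q a 0)
    (hA : ∀ n, a n < m → tailVal q a (n + 1) ≤ 1)
    (hB : ∀ n, 0 < a n → m / (q - 1) - tailVal q a (n + 1) ≤ 1)
    {n : ℕ} (hn : ∀ i < n, c i = a i) (hne : c n ≠ a n) :
    (c n = a n + 1 ∧ (∀ i, c (n + 1 + i) = 0) ∧ tailVal q a (n + 1) = 1) ∨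
      (c n + 1 = a n ∧ (∀ i, c (n + 1 + i) = m) ∧ m / (q - 1) - tailVal q a (n + 1) = 1) := by
  have h1 := tailVal_eq_of_agree hq hc ha h0 hn
  have h2 := mul_tailVal hq hc n
  have h3 := mul_tailVal hq ha n
  have h4 := tailVal_nonneg hq c (n + 1)
  have h5 := tailVal_le hq hc (n + 1)
  rw [h1] at h2
  rcases hne.lt_or_gt with hlt | hlt
  · right
    have h6 := hB n (by omega)
    have h7 : (c n : ℝ) + 1 ≤ a n := by exact_mod_cast hlt
    refine ⟨?_, eq_max_of_le_tailVal hq hc (by linarith), by linarith⟩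
    have : (c n : ℝ) + 1 = a n := by linarith
    exact_mod_cast this
  · left
    have h6 := hA n (hlt.trans_le (hc n))
    have h7 : (a n : ℝ) + 1 ≤ c n := by exact_mod_cast hlt
    refine ⟨?_, eq_zero_of_tailVal_nonpos hq hc (by linarith), by linarith⟩
    have : (c n : ℝ) = a n + 1 := by linarith
    exact_mod_cast this

section Univoque

variable {q : ℝ}

theorem eq_of_isExpansionOf_one (hq : q ∈ USet) {c d : ℕ → ℕ} (hc : ∀ i, c i ≤ alphaOne q)
    (hd : ∀ i, d i ≤ alphaOne q) {n k : ℕ} (hcn : tailVal q c n = 1) (hdk : tailVal q d k = 1)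
    (i : ℕ) : c (n + i) = d (k + i) :=
  congrFun (hq.2.unique (hcn ▸ isExpansionOf_shift hc n) (hdk ▸ isExpansionOf_shift hd k)) i

theorem eq_of_tailVal_eq (hq : q ∈ USet) {c d : ℕ → ℕ} (hc : ∀ i, c i ≤ alphaOne q)
    (hd : ∀ i, d i ≤ alphaOne q) {n : ℕ} (hcd : tailVal q c n = tailVal q d n)
    (h : tailVal q d n = 1 ∨ (alphaOne q : ℝ) / (q - 1) - tailVal q d n = 1) (i : ℕ) :
    c (n + i) = d (n + i) := by
  rcases h with h | h
  · exact eq_of_isExpansionOf_one hq hc hd (hcd.trans h) h i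
  · have := eq_of_isExpansionOf_one hq (c := fun i => alphaOne q - c i)
      (d := fun i => alphaOne q - d i) (fun i => Nat.sub_le _ _) (fun i => Nat.sub_le _ _)
      (n := n) (k := n) (by rw [tailVal_conj hq.1 hc, hcd, h]) (by rw [tailVal_conj hq.1 hd, h]) i
    have h1 := hc (n + i)
    have h2 := hd (n + i)
    omega

theorem div_sub_tailVal_ne_one (hq : q ∈ USet) {a : ℕ → ℕ} (ha : ∀ i, a i ≤ alphaOne q)
    {n : ℕ} (h1 : tailVal q a n = 1) :
    (alphaOne q : ℝ) / (q - 1) - tailVal q a n ≠ 1 := by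
  intro h2
  have hlt := alphaOne_lt hq.1
  have hq1 : (0 : ℝ) < q - 1 := by linarith [hq.1]
  have h3 : (alphaOne q : ℝ) = 2 * (q - 1) := by
    rw [← div_eq_iff hq1.ne']
    linarith
  have h4 : alphaOne q < 2 := by
    have : (alphaOne q : ℝ) < 2 := by linarith
    exact_mod_cast this
  have h5 : 0 < alphaOne q := by
    have : (0 : ℝ) < alphaOne q := by linarith
    exact_mod_cast this
  have h6 := eq_of_isExpansionOf_one hq (c := fun i => alphaOne q - a i) (d := a)
      (fun i => Nat.sub_le _ _) ha (n := n) (k := n) (by rw [tailVal_conj hq.1 ha, h2]) h1 0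
  omega

theorem eq_of_ne_of_bounded_tails (hq : q ∈ USet) {a : ℕ → ℕ} (ha : ∀ i, a i ≤ alphaOne q)
    (hA : ∀ n, a n < alphaOne q → tailVal q a (n + 1) ≤ 1)
    (hB : ∀ n, 0 < a n → (alphaOne q : ℝ) / (q - 1) - tailVal q a (n + 1) ≤ 1)
    {c d : ℕ → ℕ} (hc : IsExpansionOf q (tailVal q a 0) c)
    (hd : IsExpansionOf q (tailVal q a 0) d) (hca : c ≠ a) (hda : d ≠ a) : c = d := by
  rw [isExpansionOf_iff] at hc hd
  obtain ⟨n, hn, hne⟩ := exists_first_diff hca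
  obtain ⟨k, hk, hke⟩ := exists_first_diff hda
  have hcn := first_diff_cases hq.1 ha hc.1 hc.2 hA hB hn hne
  have hdk := first_diff_cases hq.1 ha hd.1 hd.2 hA hB hk hke
  have aux : ∀ {c : ℕ → ℕ} {n k : ℕ}, (∀ i, c i ≤ alphaOne q) → tailVal q c 0 = tailVal q a 0 →
      (∀ i < k, c i = a i) → c k ≠ a k → n < k →
      (tailVal q a (n + 1) = 1 ∨ (alphaOne q : ℝ) / (q - 1) - tailVal q a (n + 1) = 1) →
      False := by
    intro c n k hc hc0 hk hke hnk h
    have h1 := tailVal_eq_of_agree hq.1 hc ha hc0 (n := n + 1) fun i hi => hk i (by omega)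
    have h2 := eq_of_tailVal_eq hq hc ha h1 h (k - (n + 1))
    rw [Nat.add_sub_cancel' hnk] at h2
    exact hke h2
  rcases lt_trichotomy n k with h | h | h
  · exact (aux hd.1 hd.2 hk hke h (hcn.imp (·.2.2) (·.2.2))).elim
  · subst h
    have hext : c n = d n → (∀ i, c (n + 1 + i) = d (n + 1 + i)) → c = d := by
      intro h1 h2
      funext i
      rcases lt_trichotomy i n with h | h | h
      · rw [hn i h, hk i h]
      · rw [h, h1]
      · have := h2 (i - (n + 1))
        rwa [Nat.add_sub_cancel' h] at this
    rcases hcn with hcn | hcn <;> rcases hdk with hdk | hdk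
    · exact hext (hcn.1.trans hdk.1.symm) fun i => (hcn.2.1 i).trans (hdk.2.1 i).symm
    · exact (div_sub_tailVal_ne_one hq ha hcn.2.2 hdk.2.2).elim
    · exact (div_sub_tailVal_ne_one hq ha hdk.2.2 hcn.2.2).elim
    · exact hext (by omega) fun i => (hcn.2.1 i).trans (hdk.2.1 i).symm
  · exact (aux hc.1 hc.2 hn hne h (hdk.imp (·.2.2) (·.2.2))).elim

end Univoque

theorem zero_mem_Uq {q : ℝ} (hq : 1 < q) : (0 : ℝ) ∈ Uq q := by
  refine ⟨fun _ => 0, isExpansionOf_iff.2 ⟨fun _ => Nat.zero_le _, by simp [tailVal]⟩, ?_⟩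
  intro c hc
  rw [isExpansionOf_iff] at hc
  funext i
  simpa using eq_zero_of_tailVal_nonpos hq hc.1 hc.2.le i

/-- If `q ∈ U`, then every `x ∈ V_q \ U_q` has exactly two expansions
in base `q`. -/
theorem two_expansions (q : ℝ) (hq : q ∈ USet) (x : ℝ) (hx : x ∈ Vq q \ Uq q) :
    {c | IsExpansionOf q x c}.ncard = 2 := by
  obtain ⟨⟨⟨hx0, hxM⟩, hV⟩, hU⟩ := hx
  have hq1 := hq.1
  have hxpos : 0 < x := lt_of_le_of_ne hx0 fun h => hU (h ▸ zero_mem_Uq hq1)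
  obtain ⟨ha, hA⟩ := quasiGreedy_spec hq1 hxpos hxM
  obtain ⟨he, -⟩ := quasiGreedy_spec hq1 one_pos (one_le_div_alphaOne hq1)
  rw [isExpansionOf_iff] at he
  set a := quasiGreedy q x
  have ha' := isExpansionOf_iff.1 ha
  have hB : ∀ n, 0 < a n → (alphaOne q : ℝ) / (q - 1) - tailVal q a (n + 1) ≤ 1 := by
    intro n hn
    rw [← tailVal_conj hq1 ha'.1]
    exact tailVal_le_one_of_lexLe hq1 he.1 he.2 (fun i => Nat.sub_le _ _)
      (fun k hk => hV k (by omega)) (hV n hn)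
  obtain ⟨c, hc, hca⟩ : ∃ c, IsExpansionOf q x c ∧ c ≠ a := by
    by_contra! h
    exact hU ⟨a, ha, h⟩
  rw [Set.ncard_eq_two]
  refine ⟨a, c, hca.symm, Set.ext fun d => ⟨fun hd => ?_, ?_⟩⟩
  · by_cases hda : d = a
    · exact Or.inl hda
    · exact Or.inr (eq_of_ne_of_bounded_tails hq ha'.1 hA hB (ha'.2.symm ▸ hd)
        (ha'.2.symm ▸ hc) hda hca)
  · rintro (rfl | rfl)
    · exact ha
    · exact hc
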